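/- arXiv:2010.13256 — 8 statements merged into one kernel-verified Lean document; each statement's English description precedes it below -/
import Mathlib

section
/- For every n ≥ 1, n! · p_{n,0} = Σ_{k=0}^{n} c(n,k) · (f_k)^2, where p_{n,0} is the number of two-way contingency tables with sum n, c(n,k) is the unsigned Stirling number of the first kind, and f_k is the k-th Fubini number. -/
/-- Stirling numbers of the second kind. -/
def S2 : ℕ → ℕ → ℕ
  | 0, 0 => 1
  | 0, _ + 1 => 0
  | _ + 1, 0 => 0
  | n + 1, k + 1 => (k + 1) * S2 n (k + 1) + S2 n k

/-- Unsigned Stirling numbers of the first kind. -/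
def c1 : ℕ → ℕ → ℕ
  | 0, 0 => 1
  | 0, _ + 1 => 0
  | _ + 1, 0 => 0
  | n + 1, k + 1 => n * c1 n (k + 1) + c1 n k

/-- The Fubini numbers (ordered Bell numbers): `f_n = ∑_{k=0}^n k! · S2(n,k)`. -/
def fubini (n : ℕ) : ℕ :=
  ∑ k ∈ Finset.range (n + 1), Nat.factorial k * S2 n k

/-- `pn0 n` is the number of two-way contingency tables with sum `n`: matrices of
nonnegative integers (of some dimensions `a × b` with `1 ≤ a, b ≤ n`) whose entries sum
to `n`, all of whose row sums and column sums are strictly positive. -/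
noncomputable def pn0 (n : ℕ) : ℕ :=
  ∑ a ∈ Finset.Icc 1 n, ∑ b ∈ Finset.Icc 1 n,
    Nat.card {M : Fin a → Fin b → ℕ //
      (∑ i, ∑ j, M i j) = n ∧ (∀ i, 0 < ∑ j, M i j) ∧ (∀ j, 0 < ∑ i, M i j)}

open Finset

theorem ascFactorial_eq_sum_c1 (m n : ℕ) :
    m.ascFactorial n = ∑ k ∈ range (n + 1), c1 n k * m ^ k := by
  have c1_eq_stirlingFirst : ∀ n k, c1 n k = n.stirlingFirst k := by
    intro n
    induction n with
    | zero => rintro (_ | k) <;> simp [c1]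
    | succ n ih => rintro (_ | k) <;> simp [c1, Nat.stirlingFirst_succ_succ, ih]
  simp only [c1_eq_stirlingFirst]
  induction n with
  | zero => simp
  | succ n ih =>
    have h : ∑ k ∈ range (n + 1), n.stirlingFirst (k + 1) * m ^ (k + 1) + n.stirlingFirst 0 =
        ∑ k ∈ range (n + 1), n.stirlingFirst k * m ^ k := by
      have h' := sum_range_succ' (fun k => n.stirlingFirst k * m ^ k) (n + 1)
      rw [sum_range_succ, Nat.stirlingFirst_eq_zero_of_lt (Nat.lt_succ_self n)] at h'
      simpa using h'.symm
    have h₀ : n * n.stirlingFirst 0 = 0 := by cases n <;> simp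
    rw [Nat.ascFactorial_succ, sum_range_succ', ih]
    simp only [Nat.stirlingFirst_succ_succ, Nat.stirlingFirst_succ_zero, add_mul, sum_add_distrib]
    have h₁ : ∑ k ∈ range (n + 1), n * n.stirlingFirst (k + 1) * m ^ (k + 1) =
        n * ∑ k ∈ range (n + 1), n.stirlingFirst k * m ^ k := by
      rw [← h, mul_add, h₀, mul_sum]
      simp only [mul_assoc, add_zero]
    have h₂ : ∑ k ∈ range (n + 1), n.stirlingFirst k * m ^ (k + 1) =
        m * ∑ k ∈ range (n + 1), n.stirlingFirst k * m ^ k := by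
      rw [mul_sum]
      exact sum_congr rfl fun k _ => by ring
    rw [h₁, h₂]
    ring

theorem S2_eq_zero_of_lt {n k : ℕ} (h : n < k) : S2 n k = 0 := by
  induction n generalizing k with
  | zero => obtain _ | k := k <;> simp_all [S2]
  | succ n ih =>
    obtain _ | k := k
    · simp at h
    · simp [S2, ih (show n < k by omega), ih (show n < k + 1 by omega)]

theorem pow_eq_sum_choose_mul_S2 (a k : ℕ) :
    a ^ k = ∑ i ∈ range (a + 1), a.choose i * (i.factorial * S2 k i) := by
  have h_desc (i : ℕ) (k : ℕ) :
      a.choose i * (i.factorial * S2 k i) = a.descFactorial i * S2 k i := by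
    rw [Nat.descFactorial_eq_factorial_mul_choose]
    ring
  simp only [h_desc]
  induction k with
  | zero => simp [sum_range_succ', S2]
  | succ k ih =>
    have step (i : ℕ) : a * a.descFactorial i = a.descFactorial (i + 1) + i * a.descFactorial i := by
      rw [Nat.descFactorial_succ, ← add_mul]
      obtain h | h := le_or_gt i a
      · rw [Nat.sub_add_cancel h]
      · simp [Nat.descFactorial_of_lt h]
    have h₁ : ∑ i ∈ range (a + 1), a.descFactorial (i + 1) * S2 k i =
        ∑ i ∈ range a, a.descFactorial (i + 1) * S2 k i := by
      simp [sum_range_succ]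
    have h₂ : ∑ i ∈ range (a + 1), i * a.descFactorial i * S2 k i =
        ∑ i ∈ range a, (i + 1) * a.descFactorial (i + 1) * S2 k (i + 1) := by
      simp [sum_range_succ']
    rw [pow_succ', ih, mul_sum]
    simp only [← mul_assoc, step, add_mul, sum_add_distrib, h₁, h₂]
    rw [sum_range_succ', ← sum_add_distrib, ← sum_add_distrib]
    simp only [S2, mul_zero, add_zero]
    exact sum_congr rfl fun i _ => by ring

theorem eq_of_sum_choose_mul_eq {f g : ℕ → ℕ}
    (h : ∀ a, ∑ i ∈ range (a + 1), a.choose i * f i = ∑ i ∈ range (a + 1), a.choose i * g i) :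
    f = g := by
  funext a
  induction a using Nat.strong_induction_on with
  | _ a ih =>
    have ha := h a
    rw [sum_range_succ, sum_range_succ,
      sum_congr rfl fun i hi => by rw [ih i (mem_range.1 hi)]] at ha
    simpa using ha

theorem eq_of_sum_sum_choose_mul_eq {f g : ℕ → ℕ → ℕ}
    (h : ∀ a b, ∑ i ∈ range (a + 1), ∑ j ∈ range (b + 1), a.choose i * (b.choose j * f i j) =
      ∑ i ∈ range (a + 1), ∑ j ∈ range (b + 1), a.choose i * (b.choose j * g i j)) :
    f = g := by
  funext i
  refine eq_of_sum_choose_mul_eq fun b => ?_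
  refine congrFun (eq_of_sum_choose_mul_eq
    (f := fun i => ∑ j ∈ range (b + 1), b.choose j * f i j)
    (g := fun i => ∑ j ∈ range (b + 1), b.choose j * g i j) fun a => ?_) i
  simpa only [mul_sum] using h a b

/-- Matrices of natural numbers with sum `n`. -/
abbrev SumMatrix (a b n : ℕ) : Type :=
  {M : Fin a → Fin b → ℕ // ∑ i, ∑ j, M i j = n}

/-- Two-way contingency tables with sum `n`. -/
abbrev ContingencyTable (a b n : ℕ) : Type :=
  {M : Fin a → Fin b → ℕ //
    (∑ i, ∑ j, M i j) = n ∧ (∀ i, 0 < ∑ j, M i j) ∧ (∀ j, 0 < ∑ i, M i j)}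

namespace SumMatrix

variable {a b n : ℕ}

/-- Matrices with sum `n` correspond to multisets of `n` cells. -/
noncomputable def equivSym (a b n : ℕ) : SumMatrix a b n ≃ Sym (Fin a × Fin b) n :=
  ((Equiv.curry (Fin a) (Fin b) ℕ).symm.subtypeEquiv fun M => by
    simp [Fintype.sum_prod_type, Function.uncurry]).trans
    (Sym.equivNatSumOfFintype (Fin a × Fin b) n).symm

instance : Finite (SumMatrix a b n) :=
  Finite.of_equiv _ (equivSym a b n).symm

theorem factorial_mul_card (a b n : ℕ) :
    n.factorial * Nat.card (SumMatrix a b n) = (a * b).ascFactorial n := by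
  rw [Nat.card_congr (equivSym a b n), Nat.card_eq_fintype_card, Sym.card_sym_eq_multichoose,
    Nat.multichoose_eq, Fintype.card_prod, Fintype.card_fin, Fintype.card_fin,
    Nat.ascFactorial_eq_factorial_mul_choose']

/-- The sets of nonzero rows and of nonzero columns. -/
def lineSupport (M : SumMatrix a b n) : Finset (Fin a) × Finset (Fin b) :=
  (univ.filter fun i => 0 < ∑ j, M.1 i j, univ.filter fun j => 0 < ∑ i, M.1 i j)

theorem lineSupport_eq_iff {M : SumMatrix a b n} {s : Finset (Fin a)} {t : Finset (Fin b)} :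
    M.lineSupport = (s, t) ↔
      (∀ i, i ∈ s ↔ 0 < ∑ j, M.1 i j) ∧ (∀ j, j ∈ t ↔ 0 < ∑ i, M.1 i j) := by
  simp [lineSupport, Prod.ext_iff, Finset.ext_iff, iff_comm]

theorem apply_eq_zero {M : SumMatrix a b n} {s : Finset (Fin a)} {t : Finset (Fin b)}
    (h : M.lineSupport = (s, t)) (i : Fin a) (j : Fin b) (hij : i ∉ s ∨ j ∉ t) :
    M.1 i j = 0 := by
  rw [lineSupport_eq_iff] at h
  rw [h.1, h.2] at hij
  simp only [not_lt, nonpos_iff_eq_zero, sum_eq_zero_iff, mem_univ, true_imp_iff] at hij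
  exact hij.elim (fun h => h j) fun h => h i

end SumMatrix

theorem sum_equivFin_symm {ι : Type*} [Fintype ι] (s : Finset ι) (f : ι → ℕ)
    (h : ∀ i ∉ s, f i = 0) : ∑ k, f (s.equivFin.symm k) = ∑ i, f i := by
  rw [Equiv.sum_comp s.equivFin.symm fun i : s => f i, sum_coe_sort]
  exact sum_subset (subset_univ s) fun i _ hi => h i hi

namespace SumMatrix

variable {a b n : ℕ}

/-- Deleting the zero rows and columns of a matrix leaves a contingency table. -/
noncomputable def fiberEquiv (s : Finset (Fin a)) (t : Finset (Fin b)) :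
    {M : SumMatrix a b n // M.lineSupport = (s, t)} ≃ ContingencyTable #s #t n where
  toFun M := ⟨fun k l => M.1.1 (s.equivFin.symm k) (t.equivFin.symm l), by
    obtain ⟨M, hM⟩ := M
    have hrow (i : Fin a) : ∑ l, M.1 i (t.equivFin.symm l) = ∑ j, M.1 i j :=
      sum_equivFin_symm t _ fun j hj => apply_eq_zero hM i j (.inr hj)
    have hcol (j : Fin b) : ∑ k, M.1 (s.equivFin.symm k) j = ∑ i, M.1 i j :=
      sum_equivFin_symm s (M.1 · j) fun i hi => apply_eq_zero hM i j (.inl hi)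
    have hM' := lineSupport_eq_iff.1 hM
    refine ⟨?_, fun k => ?_, fun l => ?_⟩
    · simp only [hrow]
      rw [sum_equivFin_symm s fun i => ∑ j, M.1 i j, M.2]
      exact fun i hi => sum_eq_zero fun j _ => apply_eq_zero hM i j (.inl hi)
    · rw [hrow]
      exact (hM'.1 _).1 (s.equivFin.symm k).2
    · rw [hcol]
      exact (hM'.2 _).1 (t.equivFin.symm l).2⟩
  invFun N :=
    let M : Fin a → Fin b → ℕ := fun i j =>
      if hi : i ∈ s then if hj : j ∈ t then N.1 (s.equivFin ⟨i, hi⟩) (t.equivFin ⟨j, hj⟩) else 0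
      else 0
    have hrow (i : Fin a) (hi : i ∈ s) : ∑ j, M i j = ∑ l, N.1 (s.equivFin ⟨i, hi⟩) l := by
      rw [← sum_equivFin_symm t]
      · simp [M, hi]
      · simp +contextual [M]
    have hcol (j : Fin b) (hj : j ∈ t) : ∑ i, M i j = ∑ k, N.1 k (t.equivFin ⟨j, hj⟩) := by
      rw [← sum_equivFin_symm s]
      · simp [M, hj]
      · simp +contextual [M]
    have hsum : ∑ i, ∑ j, M i j = n := by
      rw [← sum_equivFin_symm s, ← N.2.1]
      · simp [hrow]
      · simp +contextual [M]
    ⟨⟨M, hsum⟩, lineSupport_eq_iff.2 ⟨fun i => by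
      by_cases hi : i ∈ s
      · simp only [hi, hrow i hi, N.2.2.1]
      · simp [M, hi], fun j => by
      by_cases hj : j ∈ t
      · simp only [hj, hcol j hj, N.2.2.2]
      · simp [M, hj]⟩⟩
  left_inv := by
    rintro ⟨M, hM⟩
    ext i j
    by_cases hi : i ∈ s <;> by_cases hj : j ∈ t <;>
      simp [hi, hj, apply_eq_zero hM i j]
  right_inv N := by
    ext k l
    simp

theorem card_eq_sum (a b n : ℕ) :
    Nat.card (SumMatrix a b n) = ∑ i ∈ range (a + 1), ∑ j ∈ range (b + 1),
      a.choose i * (b.choose j * Nat.card (ContingencyTable i j n)) := by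
  rw [← Nat.card_congr (Equiv.sigmaFiberEquiv (lineSupport (a := a) (b := b) (n := n))),
    Nat.card_sigma, Fintype.sum_prod_type]
  simp only [Nat.card_congr (fiberEquiv _ _)]
  have hcols (k : ℕ) : ∑ t : Finset (Fin b), Nat.card (ContingencyTable k #t n) =
      ∑ j ∈ range (b + 1), b.choose j * Nat.card (ContingencyTable k j n) := by
    simpa using sum_powerset_apply_card (fun j => Nat.card (ContingencyTable k j n))
      (x := (univ : Finset (Fin b)))
  simp only [hcols]
  simpa [mul_sum] using sum_powerset_apply_card
    (fun i => ∑ j ∈ range (b + 1), b.choose j * Nat.card (ContingencyTable i j n))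
    (x := (univ : Finset (Fin a)))

end SumMatrix

theorem factorial_mul_card_contingencyTable (a b n : ℕ) :
    n.factorial * Nat.card (ContingencyTable a b n) =
      ∑ k ∈ range (n + 1), c1 n k * ((a.factorial * S2 k a) * (b.factorial * S2 k b)) := by
  refine congrFun₂ (eq_of_sum_sum_choose_mul_eq
    (f := fun a b => n.factorial * Nat.card (ContingencyTable a b n))
    (g := fun a b => ∑ k ∈ range (n + 1),
      c1 n k * ((a.factorial * S2 k a) * (b.factorial * S2 k b))) fun a b => ?_) a b
  calc
    _ = n.factorial * Nat.card (SumMatrix a b n) := by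
      simp only [SumMatrix.card_eq_sum, mul_sum]
      exact sum_congr rfl fun i _ => sum_congr rfl fun j _ => by ring
    _ = ∑ k ∈ range (n + 1), c1 n k * (a ^ k * b ^ k) := by
      simp only [SumMatrix.factorial_mul_card, ascFactorial_eq_sum_c1, mul_pow]
    _ = ∑ k ∈ range (n + 1), ∑ i ∈ range (a + 1), ∑ j ∈ range (b + 1), a.choose i *
          (b.choose j * (c1 n k * ((i.factorial * S2 k i) * (j.factorial * S2 k j)))) := by
      refine sum_congr rfl fun k _ => ?_
      rw [pow_eq_sum_choose_mul_S2 a, pow_eq_sum_choose_mul_S2 b, sum_mul_sum]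
      simp only [mul_sum]
      exact sum_congr rfl fun i _ => sum_congr rfl fun j _ => by ring
    _ = _ := by
      rw [sum_comm]
      refine sum_congr rfl fun i _ => ?_
      rw [sum_comm]
      simp only [mul_sum]

theorem fubini_eq_sum_Icc {k n : ℕ} (hk : 1 ≤ k) (hkn : k ≤ n) :
    fubini k = ∑ i ∈ Icc 1 n, i.factorial * S2 k i := by
  calc
    _ = ∑ i ∈ range (n + 1), i.factorial * S2 k i :=
      sum_subset (range_subset_range.2 (Nat.succ_le_succ hkn)) fun i _ hi => by
        rw [S2_eq_zero_of_lt (by simpa using hi), mul_zero]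
    _ = _ := by
      refine (sum_subset (fun i hi => by simp at hi ⊢; omega) fun i hi hi' => ?_).symm
      obtain ⟨k, rfl⟩ := Nat.exists_eq_add_of_le' hk
      obtain rfl : i = 0 := by simp at hi hi'; omega
      rw [S2, mul_zero]

theorem pn0_stirling_fubini (n : ℕ) (hn : 1 ≤ n) :
    Nat.factorial n * pn0 n = ∑ k ∈ Finset.range (n + 1), c1 n k * (fubini k) ^ 2 := by
  calc
    _ = ∑ a ∈ Icc 1 n, ∑ b ∈ Icc 1 n, ∑ k ∈ range (n + 1),
          c1 n k * ((a.factorial * S2 k a) * (b.factorial * S2 k b)) := by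
      simp only [pn0, mul_sum, ← factorial_mul_card_contingencyTable]
    _ = ∑ k ∈ range (n + 1), c1 n k * (∑ a ∈ Icc 1 n, a.factorial * S2 k a) ^ 2 := by
      simp only [sq, sum_mul_sum]
      simp only [mul_sum]
      rw [sum_comm (s := range (n + 1))]
      exact sum_congr rfl fun a _ => sum_comm
    _ = _ := by
      refine sum_congr rfl fun k hk => ?_
      obtain rfl | hk₀ := Nat.eq_zero_or_pos k
      · obtain ⟨n, rfl⟩ := Nat.exists_eq_add_of_le' hn
        simp [c1]
      · rw [fubini_eq_sum_Icc hk₀ (Nat.lt_succ_iff.1 (mem_range.1 hk))]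
end

section
/- Let q_{n,k} denote the number of pairs of ordered set-partitions of {1,...,n} with k distinguished consecutive embeddings. If k ≥ n and k ≥ 1, then q_{n,k} = 0. If k = n-1 and k ≥ 1, then q_{n,k} = 2·n!. -/
/-- `L` is an ordered set-partition of `{1,…,n}`: a finite sequence of nonempty pairwise
disjoint subsets of `Fin n` whose union is everything. -/
def IsOSP {n : ℕ} (L : List (Finset (Fin n))) : Prop :=
  (∀ S ∈ L, S.Nonempty) ∧ L.Pairwise Disjoint ∧ ∀ x : Fin n, ∃ S ∈ L, x ∈ S

/-- `i` is a left consecutive embedding of the pair `(A, B)`: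
`A_i ∪ A_{i+1} ⊆ B_j` for some `j`. -/
def LeftCE {n : ℕ} (A B : List (Finset (Fin n))) (i : ℕ) : Prop :=
  ∃ (h : i + 1 < A.length) (j : ℕ) (hj : j < B.length),
    A.get ⟨i, Nat.lt_of_succ_lt h⟩ ∪ A.get ⟨i + 1, h⟩ ⊆ B.get ⟨j, hj⟩

/-- The set of consecutive embeddings of the pair `(A, B)`: left consecutive embeddings
are tagged with `true`, right consecutive embeddings with `false`. -/
def CE {n : ℕ} (A B : List (Finset (Fin n))) : Set (Bool × ℕ) :=
  {p | (p.1 = true ∧ LeftCE A B p.2) ∨ (p.1 = false ∧ LeftCE B A p.2)}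

/-- `qnk n k` is the number of pairs of ordered set-partitions of `{1,…,n}` together with
a choice of `k` distinguished consecutive embeddings. -/
noncomputable def qnk (n k : ℕ) : ℕ :=
  Nat.card {x : List (Finset (Fin n)) × List (Finset (Fin n)) × Finset (Bool × ℕ) //
    IsOSP x.1 ∧ IsOSP x.2.1 ∧ (↑x.2.2 : Set (Bool × ℕ)) ⊆ CE x.1 x.2.1 ∧ x.2.2.card = k}

open Finset

namespace IsOSP

variable {n : ℕ} {A B : List (Finset (Fin n))}

theorem eq_of_mem (hA : IsOSP A) {S T : Finset (Fin n)} (hS : S ∈ A) (hT : T ∈ A)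
    {x : Fin n} (hxS : x ∈ S) (hxT : x ∈ T) : S = T := by
  by_contra hne
  exact Finset.disjoint_left.mp (hA.2.1.forall hS hT hne) hxS hxT

theorem index_eq_of_mem (hA : IsOSP A) {i j : ℕ} (hi : i < A.length) (hj : j < A.length)
    {x : Fin n} (hxi : x ∈ A[i]) (hxj : x ∈ A[j]) : i = j := by
  have h := List.pairwise_iff_getElem.mp hA.2.1
  rcases lt_trichotomy i j with hij | hij | hij
  · exact absurd hxj (Finset.disjoint_left.mp (h i j hi hj hij) hxi)
  · exact hij
  · exact absurd hxi (Finset.disjoint_left.mp (h j i hj hi hij) hxj)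

/-- Every block contains a chosen representative. -/
theorem exists_representatives (hA : IsOSP A) :
    ∃ g : Fin A.length → Fin n, Function.Injective g ∧ ∀ i, g i ∈ A[i] := by
  choose g hg using fun i : Fin A.length => hA.1 A[i] (List.getElem_mem i.2)
  refine ⟨g, fun i j hij => Fin.ext ?_, hg⟩
  have hj := hg j
  rw [← hij] at hj
  exact hA.index_eq_of_mem i.2 j.2 (hg i) hj

theorem length_le (hA : IsOSP A) : A.length ≤ n := by
  obtain ⟨g, hg, -⟩ := hA.exists_representatives
  simpa using Fintype.card_le_of_injective g hg

theorem exists_perm_of_length_eq (hA : IsOSP A) (h : A.length = n) :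
    ∃ σ : Equiv.Perm (Fin n), A = List.ofFn fun i => ({σ i} : Finset (Fin n)) := by
  obtain ⟨g, hg, hmem⟩ := hA.exists_representatives
  have hinj : Function.Injective fun i : Fin n => g (Fin.cast h.symm i) :=
    hg.comp (Fin.cast_injective _)
  refine ⟨Equiv.ofBijective _ (Finite.injective_iff_bijective.mp hinj), ?_⟩
  refine List.ext_getElem (by simp [h]) fun i hi hi' => ?_
  rw [List.getElem_ofFn]
  ext x
  simp only [Equiv.ofBijective_apply, Finset.mem_singleton]
  constructor
  · intro hx
    obtain ⟨j, rfl⟩ := (Finite.injective_iff_surjective.mp hinj) x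
    have := hA.index_eq_of_mem hi (Fin.cast h.symm j).2 hx (hmem (Fin.cast h.symm j))
    congr 1
    exact Fin.ext this.symm
  · rintro rfl
    exact hmem ⟨i, hi⟩

theorem eq_singleton_univ (hB : IsOSP B) (h : Finset.univ ∈ B) : B = [Finset.univ] := by
  have hall : ∀ T ∈ B, T = Finset.univ := fun T hT => by
    obtain ⟨x, hx⟩ := hB.1 T hT
    exact hB.eq_of_mem hT h hx (Finset.mem_univ x)
  obtain ⟨x, hx⟩ := hB.1 _ h
  have hlen : B.length = 1 := by
    have hpos := List.length_pos_of_mem h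
    by_contra hne
    have h1 : 1 < B.length := by omega
    have := hB.index_eq_of_mem (x := x) hpos h1
      (by rw [hall _ (List.getElem_mem hpos)]; exact hx)
      (by rw [hall _ (List.getElem_mem h1)]; exact hx)
    omega
  exact List.eq_replicate_iff.mpr ⟨hlen, hall⟩

theorem ofFn_perm (σ : Equiv.Perm (Fin n)) :
    IsOSP (List.ofFn fun i => ({σ i} : Finset (Fin n))) := by
  refine ⟨?_, ?_, fun x => ⟨{x}, ?_, Finset.mem_singleton_self x⟩⟩
  · intro S hS
    obtain ⟨i, rfl⟩ := (List.mem_ofFn' _ _).mp hS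
    exact Finset.singleton_nonempty _
  · rw [List.pairwise_ofFn]
    intro i j hij
    simpa using hij.ne
  · exact (List.mem_ofFn' _ _).mpr ⟨σ.symm x, by simp⟩

theorem singleton_univ [NeZero n] : IsOSP [(Finset.univ : Finset (Fin n))] := by
  refine ⟨?_, List.pairwise_singleton _ _, fun x => ⟨_, List.mem_singleton_self _, mem_univ x⟩⟩
  simp

end IsOSP

section Embeddings

variable {n : ℕ} {A B : List (Finset (Fin n))}

theorem leftCE_iff {i : ℕ} : LeftCE A B i ↔
    ∃ h : i + 1 < A.length, ∃ T ∈ B, A[i] ⊆ T ∧ A[i + 1] ⊆ T := by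
  simp only [LeftCE, List.get_eq_getElem, Finset.union_subset_iff]
  refine exists_congr fun h => ⟨?_, ?_⟩
  · rintro ⟨j, hj, hsub⟩
    exact ⟨_, List.getElem_mem hj, hsub⟩
  · rintro ⟨T, hT, hsub⟩
    obtain ⟨j, hj, rfl⟩ := List.getElem_of_mem hT
    exact ⟨j, hj, hsub⟩

open Classical in
/-- The finite set of left consecutive embeddings of `(A, B)`. -/
noncomputable def leftCEs (A B : List (Finset (Fin n))) : Finset ℕ :=
  (range (A.length - 1)).filter (LeftCE A B)

theorem mem_leftCEs {i : ℕ} : i ∈ leftCEs A B ↔ LeftCE A B i := by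
  simp only [leftCEs, mem_filter, mem_range, and_iff_right_iff_imp]
  rintro ⟨h, -⟩
  omega

open Classical in
/-- The elements lying in blocks of `A` that take part in a left consecutive embedding. -/
noncomputable def leftSupport (A B : List (Finset (Fin n))) : Finset (Fin n) :=
  univ.filter fun x => ∃ (i m : ℕ) (h : m < A.length),
    LeftCE A B i ∧ (m = i ∨ m = i + 1) ∧ x ∈ A[m]

theorem exists_ssubset_of_mem_leftSupport (hA : IsOSP A) {x : Fin n}
    (hx : x ∈ leftSupport A B) : ∃ S ∈ A, ∃ T ∈ B, S ⊂ T ∧ x ∈ S := by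
  simp only [leftSupport, mem_filter, mem_univ, true_and] at hx
  obtain ⟨i, m, h, hi, hm, hx⟩ := hx
  obtain ⟨hlt, T, hT, h₀, h₁⟩ := leftCE_iff.mp hi
  refine ⟨_, List.getElem_mem h, T, hT, ?_, hx⟩
  rcases hm with rfl | rfl
  · obtain ⟨y, hy⟩ := hA.1 _ (List.getElem_mem hlt)
    refine (ssubset_iff_of_subset h₀).mpr ⟨y, h₁ hy, fun hy' => ?_⟩
    have := hA.index_eq_of_mem _ _ hy hy'
    omega
  · obtain ⟨y, hy⟩ := hA.1 _ (List.getElem_mem (Nat.lt_of_succ_lt hlt))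
    refine (ssubset_iff_of_subset h₁).mpr ⟨y, h₀ hy, fun hy' => ?_⟩
    have := hA.index_eq_of_mem _ _ hy hy'
    omega

theorem disjoint_leftSupport (hA : IsOSP A) (hB : IsOSP B) :
    Disjoint (leftSupport A B) (leftSupport B A) := by
  refine Finset.disjoint_left.mpr fun x hx hx' => ?_
  obtain ⟨S, hS, T, hT, hST, hxS⟩ := exists_ssubset_of_mem_leftSupport hA hx
  obtain ⟨S', hS', T', hT', hST', hxS'⟩ := exists_ssubset_of_mem_leftSupport hB hx'
  obtain rfl := hA.eq_of_mem hS hT' hxS (hST'.subset hxS')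
  obtain rfl := hB.eq_of_mem hT hS' (hST.subset hxS) hxS'
  exact hST.asymm hST'

theorem card_leftCEs_lt (hA : IsOSP A) (h : (leftCEs A B).Nonempty) :
    #(leftCEs A B) < #(leftSupport A B) := by
  obtain ⟨g, hg, hmem⟩ := hA.exists_representatives
  set a := (leftCEs A B).min' h
  have ha : a ∈ leftCEs A B := min'_mem _ _
  let M : Finset ℕ := insert a ((leftCEs A B).image (· + 1))
  have hcard : #M = #(leftCEs A B) + 1 := by
    rw [card_insert_of_notMem, card_image_of_injective _ (add_left_injective 1)]
    rintro h'
    obtain ⟨b, hb, hba⟩ := mem_image.mp h'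
    have := min'_le _ b hb
    change a ≤ b at this
    omega
  have hM : ∀ m ∈ M, ∃ i, LeftCE A B i ∧ (m = i ∨ m = i + 1) := by
    intro m hm
    rcases mem_insert.mp hm with rfl | hm
    · exact ⟨_, mem_leftCEs.mp ha, Or.inl rfl⟩
    · obtain ⟨i, hi, rfl⟩ := mem_image.mp hm
      exact ⟨i, mem_leftCEs.mp hi, Or.inr rfl⟩
  have hlt : ∀ m ∈ M, m < A.length := fun m hm => by
    obtain ⟨i, ⟨hi, -⟩, hm⟩ := hM m hm
    omega
  have : #M ≤ #(leftSupport A B) := by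
    rw [← card_attach (s := M)]
    refine card_le_card_of_injOn (fun m => g ⟨m.1, hlt m.1 m.2⟩) (fun m _ => ?_)
      fun m _ m' _ hmm => Subtype.ext (congrArg Fin.val (hg hmm))
    obtain ⟨i, hi, him⟩ := hM m.1 m.2
    simp only [leftSupport, coe_filter, mem_univ, true_and, Set.mem_ofPred_eq]
    exact ⟨i, m.1, hlt m.1 m.2, hi, him, hmem ⟨m.1, hlt m.1 m.2⟩⟩
  omega

theorem card_leftSupport_add_le (hA : IsOSP A) (hB : IsOSP B) :
    #(leftSupport A B) + #(leftSupport B A) ≤ n := by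
  rw [← card_union_of_disjoint (disjoint_leftSupport hA hB)]
  simpa using card_le_univ (leftSupport A B ∪ leftSupport B A)

theorem coe_subset_CE_iff {S : Finset (Bool × ℕ)} : (S : Set (Bool × ℕ)) ⊆ CE A B ↔
    S ⊆ {true} ×ˢ leftCEs A B ∪ {false} ×ˢ leftCEs B A := by
  simp only [Set.subset_def, Finset.subset_iff, CE, mem_coe, Set.mem_ofPred_eq, mem_union,
    mem_product, mem_singleton, mem_leftCEs]

theorem card_le_of_subset_CE {S : Finset (Bool × ℕ)} (hS : (S : Set (Bool × ℕ)) ⊆ CE A B) :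
    #S ≤ #(leftCEs A B) + #(leftCEs B A) := by
  refine (card_le_card (coe_subset_CE_iff.mp hS)).trans ((card_union_le _ _).trans ?_)
  simp

theorem card_lt_of_subset_CE (hA : IsOSP A) (hB : IsOSP B) {S : Finset (Bool × ℕ)}
    (hS : (S : Set (Bool × ℕ)) ⊆ CE A B) (hpos : 1 ≤ #S) : #S < n := by
  have h := card_le_of_subset_CE hS
  have hsum := card_leftSupport_add_le hA hB
  rcases (leftCEs A B).eq_empty_or_nonempty with h₁ | h₁ <;>
    rcases (leftCEs B A).eq_empty_or_nonempty with h₂ | h₂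
  · simp [h₁, h₂] at h
    simp [h] at hpos
  · have := card_leftCEs_lt hB h₂
    simp [h₁] at h
    omega
  · have := card_leftCEs_lt hA h₁
    simp [h₂] at h
    omega
  · have := card_leftCEs_lt hA h₁
    have := card_leftCEs_lt hB h₂
    omega

theorem leftCEs_eq_empty_or (hA : IsOSP A) (hB : IsOSP B) {S : Finset (Bool × ℕ)}
    (hS : (S : Set (Bool × ℕ)) ⊆ CE A B) (hcard : n ≤ #S + 1) :
    leftCEs A B = ∅ ∨ leftCEs B A = ∅ := by
  by_contra! hne
  have h := card_le_of_subset_CE hS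
  have hsum := card_leftSupport_add_le hA hB
  have := card_leftCEs_lt hA hne.1
  have := card_leftCEs_lt hB hne.2
  omega

theorem leftCEs_subset_range (hA : IsOSP A) : leftCEs A B ⊆ range (n - 1) := by
  intro i hi
  obtain ⟨h, -⟩ := mem_leftCEs.mp hi
  have := hA.length_le
  rw [mem_range]
  omega

theorem eq_of_card_leftCEs (hn : 2 ≤ n) (hA : IsOSP A) (hB : IsOSP B)
    (h : leftCEs A B = range (n - 1)) :
    (∃ σ : Equiv.Perm (Fin n), A = List.ofFn fun i => ({σ i} : Finset (Fin n))) ∧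
      B = [univ] := by
  have hCE : ∀ i, i < n - 1 → LeftCE A B i := fun i hi =>
    mem_leftCEs.mp (h ▸ mem_range.mpr hi)
  have hlen : A.length = n := by
    obtain ⟨hl, -⟩ := hCE (n - 2) (by omega)
    have := hA.length_le
    omega
  refine ⟨hA.exists_perm_of_length_eq hlen, hB.eq_singleton_univ ?_⟩
  obtain ⟨_, T, hT, hT₀, -⟩ := leftCE_iff.mp (hCE 0 (by omega))
  have hsub : ∀ i (hi : i < A.length), A[i] ⊆ T := by
    intro i
    induction i with
    | zero => exact fun _ => hT₀
    | succ i ih =>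
      intro hi
      obtain ⟨hl, T', hT', h₀, h₁⟩ := leftCE_iff.mp (hCE i (by omega))
      obtain ⟨x, hx⟩ := hA.1 _ (List.getElem_mem (Nat.lt_of_succ_lt hi))
      rwa [hB.eq_of_mem hT hT' (ih _ hx) (h₀ hx)]
  convert hT
  refine (eq_univ_iff_forall.mpr fun x => ?_).symm
  obtain ⟨S, hS, hx⟩ := hA.2.2 x
  obtain ⟨i, hi, rfl⟩ := List.getElem_of_mem hS
  exact hsub i hi hx

theorem leftCE_ofFn_singleton_univ (σ : Equiv.Perm (Fin n)) {i : ℕ} (hi : i < n - 1) :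
    LeftCE (List.ofFn fun i => ({σ i} : Finset (Fin n))) [univ] i :=
  leftCE_iff.mpr ⟨by rw [List.length_ofFn]; omega, univ, List.mem_singleton_self _,
    subset_univ _, subset_univ _⟩

theorem eq_of_leftCEs_eq_empty (hn : 2 ≤ n) (hA : IsOSP A) (hB : IsOSP B)
    {S : Finset (Bool × ℕ)} {b : Bool} (hS : S ⊆ {b} ×ˢ leftCEs A B) (hcard : #S = n - 1) :
    (∃ σ : Equiv.Perm (Fin n), A = List.ofFn fun i => ({σ i} : Finset (Fin n))) ∧
      B = [univ] ∧ S = {b} ×ˢ range (n - 1) := by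
  have hsub := leftCEs_subset_range (B := B) hA
  have hle := card_le_card hS
  rw [card_product, card_singleton, one_mul] at hle
  have hL : leftCEs A B = range (n - 1) :=
    eq_of_subset_of_card_le hsub (by rw [card_range]; omega)
  obtain ⟨hσ, hB'⟩ := eq_of_card_leftCEs hn hA hB hL
  refine ⟨hσ, hB', eq_of_subset_of_card_le (hL ▸ hS) ?_⟩
  simp [hcard]

end Embeddings

theorem qnk_eq_zero_of_le {n k : ℕ} (hnk : n ≤ k) (hk : 1 ≤ k) : qnk n k = 0 := by
  refine Nat.card_eq_zero.mpr (Or.inl ⟨?_⟩)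
  rintro ⟨⟨A, B, S⟩, hA, hB, hS, hcard⟩
  exact (card_lt_of_subset_CE hA hB hS (hk.trans hcard.ge)).not_ge (hnk.trans hcard.ge)

/-- The pair consisting of the singletons ordered by `σ` and the one-block partition, in the order
given by `b`, with all its consecutive embeddings distinguished. -/
def extremalTriple {n : ℕ} (p : Bool × Equiv.Perm (Fin n)) :
    List (Finset (Fin n)) × List (Finset (Fin n)) × Finset (Bool × ℕ) :=
  match p with
  | (true, σ) => (List.ofFn fun i => {σ i}, [univ], {true} ×ˢ range (n - 1))
  | (false, σ) => ([univ], List.ofFn fun i => {σ i}, {false} ×ˢ range (n - 1))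

theorem extremalTriple_injective {n : ℕ} (hn : 2 ≤ n) :
    Function.Injective (extremalTriple (n := n)) := by
  have hofFn : ∀ σ τ : Equiv.Perm (Fin n),
      (List.ofFn fun i => ({σ i} : Finset (Fin n))) = List.ofFn (fun i => {τ i}) → σ = τ := by
    intro σ τ h
    ext1 i
    exact Finset.singleton_injective (congrFun (List.ofFn_injective h) i)
  have hne : ∀ σ : Equiv.Perm (Fin n),
      (List.ofFn fun i => ({σ i} : Finset (Fin n))) ≠ [univ] := by
    intro σ h
    have := congrArg List.length h
    simp at this
    omega
  rintro ⟨_ | _, σ⟩ ⟨_ | _, τ⟩ h <;> simp only [extremalTriple, Prod.mk.injEq] at h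
  · rw [hofFn _ _ h.2.1]
  · exact absurd h.1.symm (hne τ)
  · exact absurd h.1 (hne σ)
  · rw [hofFn _ _ h.1]

theorem range_extremalTriple {n : ℕ} (hn : 2 ≤ n) :
    Set.range (extremalTriple (n := n)) = {x | IsOSP x.1 ∧ IsOSP x.2.1 ∧
      (↑x.2.2 : Set (Bool × ℕ)) ⊆ CE x.1 x.2.1 ∧ #x.2.2 = n - 1} := by
  have : NeZero n := ⟨by omega⟩
  ext ⟨A, B, S⟩
  constructor
  · rintro ⟨⟨_ | _, σ⟩, h⟩ <;> simp only [extremalTriple, Prod.mk.injEq] at h <;>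
      obtain ⟨rfl, rfl, rfl⟩ := h
    · refine ⟨.singleton_univ, .ofFn_perm σ, coe_subset_CE_iff.mpr ?_, by simp⟩
      exact (product_subset_product_right fun i hi =>
        mem_leftCEs.mpr (leftCE_ofFn_singleton_univ σ (mem_range.mp hi))).trans subset_union_right
    · refine ⟨.ofFn_perm σ, .singleton_univ, coe_subset_CE_iff.mpr ?_, by simp⟩
      exact (product_subset_product_right fun i hi =>
        mem_leftCEs.mpr (leftCE_ofFn_singleton_univ σ (mem_range.mp hi))).trans subset_union_left
  · rintro ⟨hA, hB, hS, hcard⟩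
    simp only at hA hB hS hcard
    have hS' := coe_subset_CE_iff.mp hS
    rcases leftCEs_eq_empty_or hA hB hS (by omega) with h | h <;> rw [h] at hS'
    · obtain ⟨⟨σ, rfl⟩, rfl, rfl⟩ :=
        eq_of_leftCEs_eq_empty hn hB hA (b := false) (by simpa using hS') hcard
      exact ⟨(false, σ), rfl⟩
    · obtain ⟨⟨σ, rfl⟩, rfl, rfl⟩ :=
        eq_of_leftCEs_eq_empty hn hA hB (b := true) (by simpa using hS') hcard
      exact ⟨(true, σ), rfl⟩

theorem qnk_sub_one {n : ℕ} (hn : 2 ≤ n) : qnk n (n - 1) = 2 * Nat.factorial n := by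
  have h := Nat.card_range_of_injective (extremalTriple_injective hn)
  rw [range_extremalTriple hn] at h
  exact h.trans (by simp [Nat.card_eq_fintype_card, Fintype.card_perm])

theorem qnk_large_k (n k : ℕ) :
    (n ≤ k → 1 ≤ k → qnk n k = 0) ∧
    (k = n - 1 → 1 ≤ k → qnk n k = 2 * Nat.factorial n) := by
  refine ⟨qnk_eq_zero_of_le, ?_⟩
  rintro rfl hk
  exact qnk_sub_one (by omega)
end

section
/- Let (A,B) be a pair of ordered set-partitions of {1,...,n}, with A = (S_1,...,S_k) and B = (T_1,...,T_{k'}). Suppose i is a left consecutive embedding (so S_i ∪ S_{i+1} ⊆ T_j for some j) and i' is a right consecutive embedding (so T_{i'} ∪ T_{i'+1} ⊆ S_{j'} for some j'). Then (S_i ∪ S_{i+1}) ∩ (T_{i'} ∪ T_{i'+1}) = ∅; that is, a left consecutive embedding and a right consecutive embedding have no elements of {1,...,n} in common. -/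
/-- The blocks of an ordered set-partition containing a given element have equal indices. -/
theorem IsOSP.index_unique {n : ℕ} {L : List (Finset (Fin n))} (hL : IsOSP L)
    {a b : Fin L.length} {x : Fin n} (ha : x ∈ L.get a) (hb : x ∈ L.get b) : a = b := by
  rcases lt_trichotomy a b with h | h | h
  · exact absurd hb (Finset.disjoint_left.mp (List.pairwise_iff_get.mp hL.2.1 a b h) ha)
  · exact h
  · exact absurd ha (Finset.disjoint_left.mp (List.pairwise_iff_get.mp hL.2.1 b a h) hb)

/-- A block of an ordered set-partition contained in another block has the same index. -/
theorem IsOSP.index_eq_of_subset {n : ℕ} {L : List (Finset (Fin n))} (hL : IsOSP L)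
    {a b : Fin L.length} (h : L.get a ⊆ L.get b) : a = b := by
  obtain ⟨x, hx⟩ := hL.1 _ (List.get_mem L a)
  exact hL.index_unique hx (h hx)

theorem left_right_embeddings_disjoint (n : ℕ)
    (A B : List (Finset (Fin n))) (hA : IsOSP A) (hB : IsOSP B)
    (i : ℕ) (hi : i + 1 < A.length) (j : ℕ) (hj : j < B.length)
    (hleft : A.get ⟨i, Nat.lt_of_succ_lt hi⟩ ∪ A.get ⟨i + 1, hi⟩ ⊆ B.get ⟨j, hj⟩)
    (i' : ℕ) (hi' : i' + 1 < B.length) (j' : ℕ) (hj' : j' < A.length)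
    (hright : B.get ⟨i', Nat.lt_of_succ_lt hi'⟩ ∪ B.get ⟨i' + 1, hi'⟩ ⊆ A.get ⟨j', hj'⟩) :
    (A.get ⟨i, Nat.lt_of_succ_lt hi⟩ ∪ A.get ⟨i + 1, hi⟩) ∩
      (B.get ⟨i', Nat.lt_of_succ_lt hi'⟩ ∪ B.get ⟨i' + 1, hi'⟩) = ∅ := by
  refine Finset.eq_empty_of_forall_notMem fun x hx => ?_
  obtain ⟨hxA, hxB⟩ := Finset.mem_inter.mp hx
  have hsub : B.get ⟨j, hj⟩ ⊆ A.get ⟨j', hj'⟩ := by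
    rcases Finset.mem_union.mp hxB with h | h
    · rw [hB.index_unique (hleft hxA) h]
      exact Finset.union_subset_left hright
    · rw [hB.index_unique (hleft hxA) h]
      exact Finset.union_subset_right hright
  have h₁ := hA.index_eq_of_subset ((Finset.union_subset_left hleft).trans hsub)
  have h₂ := hA.index_eq_of_subset ((Finset.union_subset_right hleft).trans hsub)
  have h := congrArg Fin.val (h₁.trans h₂.symm)
  exact absurd h (Nat.lt_succ_self i).ne
end

section
/- For all integers 0 ≤ 2c ≤ t, Σ_{k=c}^{t-c} (-1)^k (c+k)! · S2(t, c+k) · C(k-1, k-c) = (-1)^c · 2^c · E(t,c), where E(t,c) = #{ f : {1,...,t} → {1,...,c} : f is surjective and every fiber f^{-1}(i) has even cardinality } (the number of ordered set-partitions of {1,...,t} into c parts of even cardinality). In particular, if t is odd then Σ_{k=c}^{t-c} (-1)^k (c+k)! · S2(t, c+k) · C(k-1, k-c) = 0. -/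
/-- `evenOSP t c` is the number of ordered set-partitions of `{1,…,t}` into `c` parts of
even cardinality, realized as surjections `Fin t → Fin c` all of whose fibers have even
cardinality. -/
noncomputable def evenOSP (t c : ℕ) : ℕ :=
  Nat.card {f : Fin t → Fin c // Function.Surjective f ∧
    ∀ i : Fin c, Even (Finset.univ.filter (fun x => f x = i)).card}

open Finset in
/-- An expansion of iterated forward differences at `-c` in iterated differences at `0`; it
terminates when the differences of `f` of order greater than `t` vanish. -/
theorem fwdDiff_iter_neg_eq_sum {f : ℤ → ℤ} {t : ℕ}
    (hf : ∀ n, t < n → (fwdDiff 1)^[n] f = 0) (c n N : ℕ) (h : t < n + N) :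
    (fwdDiff 1)^[n] f (-c : ℤ) =
      ∑ m ∈ range N, (-1) ^ m * ((c + m - 1).choose m : ℤ) * (fwdDiff 1)^[n + m] f 0 := by
  induction c generalizing n N with
  | zero =>
    cases N with
    | zero => simp [hf n (by omega)]
    | succ N => simp [sum_range_succ']
  | succ c ih =>
    induction N generalizing n with
    | zero => simp [hf n (by omega)]
    | succ N ihN =>
      have hstep : (fwdDiff 1)^[n] f (-(c + 1 : ℕ) : ℤ) =
          (fwdDiff 1)^[n] f (-c : ℤ) - (fwdDiff 1)^[n + 1] f (-(c + 1 : ℕ) : ℤ) := by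
        rw [Function.iterate_succ_apply', fwdDiff]
        push_cast
        ring_nf
      rw [hstep, ih n (N + 1) h, ihN (n + 1) (by omega), sum_range_succ', sum_range_succ' _ N,
        add_sub_right_comm, ← sum_sub_distrib]
      congr 1
      · refine sum_congr rfl fun m _ ↦ ?_
        have hchoose : (c + 1 + (m + 1) - 1).choose (m + 1) =
            (c + 1 + m - 1).choose m + (c + (m + 1) - 1).choose (m + 1) := by
          rw [show c + 1 + (m + 1) - 1 = (c + m) + 1 by omega, Nat.choose_succ_succ,
            show c + 1 + m - 1 = c + m by omega, show c + (m + 1) - 1 = c + m by omega]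
        rw [hchoose, show n + 1 + m = n + (m + 1) by omega]
        push_cast
        ring
      · simp

/-- A Leibniz rule for iterated forward differences of `x ↦ x * g x`. -/
theorem fwdDiff_iter_succ_id_mul (g : ℤ → ℤ) (n : ℕ) (y : ℤ) :
    (fwdDiff 1)^[n + 1] (fun x ↦ x * g x) y =
      (y + (n + 1)) * (fwdDiff 1)^[n + 1] g y + (n + 1) * (fwdDiff 1)^[n] g y := by
  induction n generalizing y with
  | zero => simp [fwdDiff]; ring
  | succ n ih =>
    rw [Function.iterate_succ_apply', fwdDiff, ih, ih, Function.iterate_succ_apply' _ (n + 1) g]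
    simp only [Function.iterate_succ_apply' _ n g, fwdDiff]
    push_cast
    ring

theorem factorial_mul_S2_eq_fwdDiff_iter (t n : ℕ) :
    (n.factorial : ℤ) * S2 t n = (fwdDiff 1)^[n] (fun x : ℤ ↦ x ^ t) 0 := by
  induction t generalizing n with
  | zero =>
    cases n with
    | zero => simp [S2]
    | succ n => rw [fwdDiff_iter_pow_eq_zero_of_lt n.succ_pos]; simp [S2]
  | succ t ih =>
    cases n with
    | zero => simp [S2]
    | succ n =>
      simp only [pow_succ', fwdDiff_iter_succ_id_mul, ← ih, S2, Nat.factorial_succ]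
      push_cast
      ring

/-- The even central difference of order `2 * c`, expanded as an iteration of
`f ↦ f (· + 1) + f (· - 1) - 2 * f`. -/
theorem sum_prod_weights_eq_fwdDiff_iter (c : ℕ) (f : ℤ → ℤ) (x : ℤ) :
    ∑ σ : Fin c → Fin 3, (∏ i, (![1, 1, -2] : Fin 3 → ℤ) (σ i)) *
        f (x + ∑ i, (![1, -1, 0] : Fin 3 → ℤ) (σ i)) =
      (fwdDiff 1)^[2 * c] f (x - c) := by
  induction c generalizing x with
  | zero => simp
  | succ c ih =>
    rw [← (Fin.consEquiv fun _ : Fin (c + 1) ↦ Fin 3).sum_comp, Fintype.sum_prod_type]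
    simp only [Fin.consEquiv_apply, Fin.prod_univ_succ, Fin.sum_univ_succ (n := c), Fin.cons_zero,
      Fin.cons_succ, mul_assoc, ← Finset.mul_sum, ← add_assoc, ih]
    rw [Fin.sum_univ_three, show 2 * (c + 1) = 2 * c + 1 + 1 by ring]
    simp only [Function.iterate_succ_apply', fwdDiff]
    simp
    ring_nf

open Finset in
theorem sum_prod_fiber_weights (t c : ℕ) :
    ∑ g : Fin t → Fin c, ∏ i, ∑ s, (![1, 1, -2] : Fin 3 → ℤ) s *
        (![1, -1, 0] : Fin 3 → ℤ) s ^ #{x | g x = i} =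
      (fwdDiff 1)^[2 * c] (fun x : ℤ ↦ x ^ t) (-c) := by
  have h := sum_prod_weights_eq_fwdDiff_iter c (fun x ↦ x ^ t) 0
  simp only [zero_add, zero_sub] at h
  rw [← h]
  simp only [prod_univ_sum, Fintype.piFinset_univ, prod_mul_distrib]
  rw [sum_comm]
  refine sum_congr rfl fun σ _ ↦ ?_
  rw [← mul_sum, sum_pow', Fintype.piFinset_univ]
  congr 1
  refine sum_congr rfl fun g _ ↦ ?_
  rw [← prod_fiberwise' univ g fun i ↦ (![1, -1, 0] : Fin 3 → ℤ) (σ i)]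
  simp only [prod_const]

theorem sum_weights_mul_pow (n : ℕ) :
    ∑ s, (![1, 1, -2] : Fin 3 → ℤ) s * (![1, -1, 0] : Fin 3 → ℤ) s ^ n =
      if n ≠ 0 ∧ Even n then 2 else 0 := by
  rcases eq_or_ne n 0 with rfl | hn
  · simp [Fin.sum_univ_three]
  · rcases n.even_or_odd with he | ho
    · simp [Fin.sum_univ_three, hn, he]
    · simp [Fin.sum_univ_three, hn, ho, Nat.not_even_iff_odd.mpr ho]

open Finset in
theorem two_pow_mul_evenOSP (t c : ℕ) :
    (2 : ℤ) ^ c * evenOSP t c = (fwdDiff 1)^[2 * c] (fun x : ℤ ↦ x ^ t) (-c) := by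
  classical
  rw [← sum_prod_fiber_weights, evenOSP, Nat.card_eq_fintype_card, Fintype.card_subtype,
    card_eq_sum_ones, sum_filter]
  push_cast
  rw [mul_sum]
  refine sum_congr rfl fun g _ ↦ ?_
  have hsurj : Function.Surjective g ↔ ∀ i, #{x | g x = i} ≠ 0 := by
    simp [Function.Surjective, filter_eq_empty_iff]
  simp only [sum_weights_mul_pow, hsurj, ← forall_and]
  split_ifs with h
  · rw [prod_congr rfl fun i _ ↦ if_pos (h i)]
    simp
  · push Not at h
    obtain ⟨i, hi⟩ := h
    rw [mul_zero, prod_eq_zero (mem_univ i)]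
    exact if_neg fun h ↦ hi h.1 h.2

open Finset in
theorem evenOSP_eq_zero_of_odd {t : ℕ} (c : ℕ) (ht : Odd t) : evenOSP t c = 0 := by
  have : IsEmpty {f : Fin t → Fin c // Function.Surjective f ∧
      ∀ i : Fin c, Even (#{x | f x = i})} := by
    refine ⟨fun ⟨f, _, hf⟩ ↦ Nat.not_even_iff_odd.mpr ht ?_⟩
    have hcard := card_eq_sum_card_fiberwise (f := f) (s := univ) (t := univ)
      fun _ _ ↦ mem_coe.mpr (mem_univ _)
    rw [card_univ, Fintype.card_fin] at hcard
    rw [hcard]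
    exact even_sum _ fun i _ ↦ hf i
  exact Nat.card_of_isEmpty

theorem htc_combinatorial (t c : ℕ) (h : 2 * c ≤ t) :
    (∑ k ∈ Finset.Icc c (t - c),
        (-1 : ℤ) ^ k * (Nat.factorial (c + k) : ℤ) * (S2 t (c + k) : ℤ) *
          (Nat.choose (k - 1) (k - c) : ℤ)) =
      (-1 : ℤ) ^ c * 2 ^ c * (evenOSP t c : ℤ) ∧
    (Odd t →
      (∑ k ∈ Finset.Icc c (t - c),
        (-1 : ℤ) ^ k * (Nat.factorial (c + k) : ℤ) * (S2 t (c + k) : ℤ) *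
          (Nat.choose (k - 1) (k - c) : ℤ)) = 0) := by
  have key : (∑ k ∈ Finset.Icc c (t - c),
        (-1 : ℤ) ^ k * (Nat.factorial (c + k) : ℤ) * (S2 t (c + k) : ℤ) *
          (Nat.choose (k - 1) (k - c) : ℤ)) =
      (-1 : ℤ) ^ c * 2 ^ c * (evenOSP t c : ℤ) := by
    rw [mul_assoc, two_pow_mul_evenOSP,
      fwdDiff_iter_neg_eq_sum (fun n hn ↦ fwdDiff_iter_pow_eq_zero_of_lt hn) c (2 * c)
        (t - c + 1 - c) (by omega),
      ← Finset.Ico_add_one_right_eq_Icc, Finset.sum_Ico_eq_sum_range, Finset.mul_sum]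
    refine Finset.sum_congr rfl fun m _ ↦ ?_
    rw [← factorial_mul_S2_eq_fwdDiff_iter, ← add_assoc c c m, ← two_mul, Nat.add_sub_cancel_left,
      pow_add]
    ring
  exact ⟨key, fun ht ↦ by simp [key, evenOSP_eq_zero_of_odd c ht]⟩
end

section
/- For all integers 0 ≤ 2c ≤ t, |h_{t,c}| ≤ 2^c · c^t, where h_{t,c} = Σ_{k=c}^{t-c} (-1)^k (c+k)! · S2(t, c+k) · C(k-1, k-c). -/
/-- `h t c = ∑_{k=c}^{t-c} (-1)^k (c+k)! · S2(t, c+k) · C(k-1, k-c)`. -/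
def hInt (t c : ℕ) : ℤ :=
  ∑ k ∈ Finset.Icc c (t - c),
    (-1 : ℤ) ^ k * (Nat.factorial (c + k) : ℤ) * (S2 t (c + k) : ℤ) *
      (Nat.choose (k - 1) (k - c) : ℤ)

open PowerSeries in
theorem coeff_exp_sub_one_pow (t k : ℕ) :
    (t.factorial : ℚ) * coeff t ((exp ℚ - 1) ^ k) = k.factorial * S2 t k := by
  induction t generalizing k with
  | zero =>
    cases k with
    | zero => simp [S2]
    | succ k => simp [S2]
  | succ t ih =>
    cases k with
    | zero => simp [S2, coeff_one]
    | succ k =>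
      have hd : derivative ℚ ((exp ℚ - 1) ^ (k + 1)) =
          ((k + 1 : ℕ) : ℚ⟦X⟧) * ((exp ℚ - 1) ^ (k + 1) + (exp ℚ - 1) ^ k) := by
        rw [Derivation.leibniz_pow]
        have : derivative ℚ (exp ℚ - 1) = exp ℚ := by
          rw [map_sub, derivative_exp]; simp
        rw [this]
        simp only [nsmul_eq_mul, smul_eq_mul, Nat.add_sub_cancel]
        ring
      have hc := congrArg (coeff t) hd
      rw [coeff_derivative, ← nsmul_eq_mul, map_nsmul, map_add, nsmul_eq_mul] at hc
      have h1 := ih (k + 1)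
      have h2 := ih k
      rw [Nat.factorial_succ t, S2]
      rw [Nat.factorial_succ k] at h1 ⊢
      push_cast at hc h1 h2 ⊢
      linear_combination (t.factorial : ℚ) * hc + (k + 1 : ℚ) * h1 + (k + 1 : ℚ) * h2

theorem one_sub_mul_sum_choose {R : Type*} [CommRing R] (z : R) (d M : ℕ) :
    (1 - z) * ∑ n ∈ Finset.range M, ((d + 1 + n).choose n : R) * z ^ n =
      ∑ n ∈ Finset.range M, ((d + n).choose n : R) * z ^ n -
        (((d + M).choose (d + 1) : ℕ) : R) * z ^ M := by
  induction M with
  | zero => simp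
  | succ M ih =>
    rw [Finset.sum_range_succ, Finset.sum_range_succ, mul_add, ih]
    have h1 : (d + 1 + M).choose M = (d + M).choose M + (d + M).choose (d + 1) := by
      rw [← Nat.choose_symm_add, show d + 1 + M = (d + M) + 1 by ring, Nat.choose_succ_succ,
        Nat.choose_symm_add]
    have h2 : (d + (M + 1)).choose (d + 1) = (d + M).choose M + (d + M).choose (d + 1) := by
      rw [← h1, ← Nat.choose_symm_add]
      congr 1; ring
    rw [h1, h2]
    push_cast
    ring

theorem pow_dvd_one_sub_pow_mul_sum_choose_sub_one {R : Type*} [CommRing R] (z : R) (d M : ℕ) :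
    z ^ M ∣ (1 - z) ^ (d + 1) * ∑ n ∈ Finset.range M, ((d + n).choose n : R) * z ^ n - 1 := by
  induction d with
  | zero =>
    simp only [zero_add, Nat.choose_self, Nat.cast_one, one_mul, pow_one, mul_neg_geom_sum]
    exact ⟨-1, by ring⟩
  | succ d ih =>
    rw [pow_succ, mul_assoc, one_sub_mul_sum_choose, mul_sub, sub_right_comm]
    exact dvd_sub ih (Dvd.intro_left _ (mul_assoc _ _ _))

open PowerSeries in
theorem abs_coeff_pow_le {f g : ℚ⟦X⟧} (h : ∀ n, |coeff n f| ≤ coeff n g) (c n : ℕ) :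
    |coeff n (f ^ c)| ≤ coeff n (g ^ c) := by
  induction c generalizing n with
  | zero =>
    rw [pow_zero, pow_zero, coeff_one]
    split_ifs <;> simp
  | succ c ih =>
    rw [pow_succ, pow_succ, coeff_mul, coeff_mul]
    refine (Finset.abs_sum_le_sum_abs _ _).trans (Finset.sum_le_sum fun p _ => ?_)
    rw [abs_mul]
    exact mul_le_mul (ih _) (h _) (abs_nonneg _) ((abs_nonneg _).trans (ih _))

open PowerSeries in
theorem abs_coeff_exp_add_exp_neg_sub_two_pow_le (c t : ℕ) :
    (t.factorial : ℚ) * |coeff t ((exp ℚ + evalNegHom (exp ℚ) - 2) ^ c)| ≤ 2 ^ c * (c : ℚ) ^ t := by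
  have h : ∀ n, |coeff n (exp ℚ + evalNegHom (exp ℚ) - 2)| ≤ coeff n ((2 : ℚ) • exp ℚ) := by
    intro n
    have h2 : (2 : ℚ⟦X⟧) = C (2 : ℚ) := (map_ofNat C 2).symm
    rw [map_sub, map_add, evalNegHom, coeff_rescale, coeff_smul, coeff_exp, h2, coeff_C]
    have hpos : (0 : ℚ) < 1 / n.factorial := by positivity
    simp only [smul_eq_mul, map_div₀, map_one, map_natCast]
    rcases eq_or_ne n 0 with rfl | hn
    · norm_num
    · rw [if_neg hn]
      rcases neg_one_pow_eq_or ℚ n with h | h <;> rw [h, abs_le] <;> constructor <;> linarith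
  have h3 := abs_coeff_pow_le h c t
  rw [smul_pow, exp_pow_eq_rescale_exp, coeff_smul, coeff_rescale, coeff_exp] at h3
  have ht : (0 : ℚ) < t.factorial := by positivity
  calc _ ≤ (t.factorial : ℚ) * _ := mul_le_mul_of_nonneg_left h3 ht.le
    _ = _ := by
      simp only [eq_ratCast, Rat.cast_eq_id, id, smul_eq_mul]
      field_simp

open PowerSeries in
theorem hInt_eq_coeff (t d : ℕ) (h : 2 * (d + 1) ≤ t) :
    (hInt t (d + 1) : ℚ) = (-1) ^ (d + 1) *
      (t.factorial * coeff t ((exp ℚ + evalNegHom (exp ℚ) - 2) ^ (d + 1))) := by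
  obtain ⟨m, rfl⟩ := Nat.exists_eq_add_of_le h
  set t := 2 * (d + 1) + m with ht
  set y : ℚ⟦X⟧ := exp ℚ - 1 with hy
  set E := evalNegHom (exp ℚ) with hE
  have hEE : exp ℚ * E = 1 := exp_mul_exp_neg_eq_one
  set S : ℚ⟦X⟧ := ∑ n ∈ Finset.range (m + 1), ((d + n).choose n : ℚ⟦X⟧) * (-y) ^ n with hS
  have hXy : (X : ℚ⟦X⟧) ∣ y := by
    rw [X_dvd_iff]; simp [hy]
  have hdvd : (X : ℚ⟦X⟧) ^ (t + 1) ∣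
      y ^ (2 * (d + 1)) * S - (exp ℚ + E - 2) ^ (d + 1) := by
    have h1 := pow_dvd_one_sub_pow_mul_sum_choose_sub_one (-y) d (m + 1)
    have h2 : (exp ℚ + E - 2) = y ^ 2 * E := by
      rw [hy]; linear_combination (2 - exp ℚ) * hEE
    have h3 : y ^ (2 * (d + 1)) * S - (exp ℚ + E - 2) ^ (d + 1) =
        y ^ (2 * (d + 1)) * (((1 - -y) ^ (d + 1) * S - 1) * E ^ (d + 1)) := by
      have h4 : (1 - -y) ^ (d + 1) * E ^ (d + 1) = 1 := by
        rw [← mul_pow, show (1 - -y) = exp ℚ by rw [hy]; ring, hEE, one_pow]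
      rw [h2, mul_pow, ← pow_mul]
      linear_combination (-(y ^ (2 * (d + 1)) * S)) * h4
    rw [h3, show t + 1 = 2 * (d + 1) + (m + 1) by omega, pow_add]
    refine mul_dvd_mul (pow_dvd_pow_of_dvd hXy _) (Dvd.dvd.mul_right ?_ _)
    exact (pow_dvd_pow_of_dvd ((dvd_neg).2 hXy) _).trans h1
  have hco := X_pow_dvd_iff.1 hdvd t (Nat.lt_succ_self t)
  rw [map_sub, sub_eq_zero] at hco
  rw [← hco, hS, Finset.mul_sum, map_sum, Finset.mul_sum, Finset.mul_sum, hInt,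
    ← Finset.Ico_add_one_right_eq_Icc, Finset.sum_Ico_eq_sum_range,
    show t - (d + 1) + 1 - (d + 1) = m + 1 by omega, Int.cast_sum]
  refine Finset.sum_congr rfl fun n _ => ?_
  have hc := coeff_exp_sub_one_pow t (d + 1 + (d + 1 + n))
  have he : y ^ (2 * (d + 1)) * (((d + n).choose n : ℚ⟦X⟧) * (-y) ^ n) =
      ((-1) ^ n * ((d + n).choose n : ℚ)) • y ^ (d + 1 + (d + 1 + n)) := by
    rw [neg_pow, smul_eq_C_mul]
    simp only [map_mul, map_pow, map_neg, map_one, map_natCast]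
    ring
  rw [he, coeff_smul, show d + 1 + n - 1 = d + n by omega, show d + 1 + n - (d + 1) = n by omega]
  push_cast
  rw [smul_eq_mul]
  linear_combination (-((-1) ^ (d + 1 + n) * ((d + n).choose n : ℚ))) * hc

theorem htc_bound (t c : ℕ) (h : 2 * c ≤ t) :
    |hInt t c| ≤ 2 ^ c * (c : ℤ) ^ t := by
  cases c with
  | zero =>
    have h0 : hInt t 0 = S2 t 0 := by
      rw [hInt, Finset.sum_eq_single 0]
      · simp
      · intro k _ hk
        rw [Nat.choose_eq_zero_of_lt (by omega : k - 1 < k - 0)]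
        simp
      · simp
    rw [h0]
    cases t <;> simp [S2]
  | succ d =>
    have hq : |(hInt t (d + 1) : ℚ)| ≤ 2 ^ (d + 1) * ((d + 1 : ℕ) : ℚ) ^ t := by
      rw [hInt_eq_coeff t d h, abs_mul, abs_mul, abs_neg_one_pow, one_mul, Nat.abs_cast]
      exact abs_coeff_exp_add_exp_neg_sub_two_pow_le (d + 1) t
    exact_mod_cast hq
end

section
/- For n ≥ 0, let E(n,k) = #{ f : {1,...,2n} → {1,...,k} : f is surjective and every fiber f^{-1}(i) has even cardinality }. Then E(n,n) = (2n)!/2^n for all n ≥ 0, and E(n,k) = k^2·E(n-1,k) + k·(2k-1)·E(n-1,k-1) for all 1 ≤ k ≤ n-1. -/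
/-- `E n k` is the number of ordered set-partitions of `{1,…,2n}` into `k` parts of even
cardinality, realized as surjections `Fin (2n) → Fin k` all of whose fibers have even
cardinality. -/
noncomputable def E (n k : ℕ) : ℕ :=
  Nat.card {f : Fin (2 * n) → Fin k // Function.Surjective f ∧
    ∀ i : Fin k, Even (Finset.univ.filter (fun x => f x = i)).card}

open PowerSeries in
theorem prod_rescale_exp {ι : Type*} (s : Finset ι) (v : ι → ℚ) :
    ∏ i ∈ s, rescale (v i) (exp ℚ) = rescale (∑ i ∈ s, v i) (exp ℚ) := by
  classical
  induction s using Finset.induction_on with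
  | empty => simp
  | insert a s ha ih =>
    rw [Finset.prod_insert ha, Finset.sum_insert ha, ih, exp_mul_exp_eq_exp_add]

/-- The nodes of the measure `(δ₁ + δ₋₁) / 2 - δ₀`. -/
def node : Fin 3 → ℚ := ![1, -1, 0]

/-- The weights of the measure `(δ₁ + δ₋₁) / 2 - δ₀`. -/
def weight : Fin 3 → ℚ := ![1 / 2, 1 / 2, -1]

/-- The moments of `(δ₁ + δ₋₁) / 2 - δ₀` are the indicator of the positive even integers. -/
theorem sum_weight_mul_node_pow (c : ℕ) :
    ∑ t, weight t * node t ^ c = if Even c ∧ c ≠ 0 then 1 else 0 := by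
  rcases eq_or_ne c 0 with rfl | hc
  · simp [Fin.sum_univ_three, weight, node]; norm_num
  · rcases Nat.even_or_odd c with h | h
    · simp [Fin.sum_univ_three, weight, node, h, hc, h.neg_one_pow]; norm_num
    · simp [Fin.sum_univ_three, weight, node, hc, h.neg_one_pow, Nat.not_even_iff_odd.mpr h]

/-- The power series `cosh X - 1`. -/
noncomputable def coshSubOne : PowerSeries ℚ :=
  ∑ t, PowerSeries.C (weight t) * PowerSeries.rescale (node t) (PowerSeries.exp ℚ)

open PowerSeries in
theorem factorial_mul_coeff_coshSubOne_pow (m k : ℕ) :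
    (m.factorial : ℚ) * coeff m (coshSubOne ^ k) =
      ∑ τ : Fin k → Fin 3, (∏ i, weight (τ i)) * (∑ i, node (τ i)) ^ m := by
  rw [coshSubOne, Fintype.sum_pow, map_sum, Finset.mul_sum]
  refine Finset.sum_congr rfl fun τ _ => ?_
  rw [Finset.prod_mul_distrib, prod_rescale_exp, ← map_prod, coeff_C_mul, coeff_rescale, coeff_exp]
  have : (m.factorial : ℚ) ≠ 0 := by positivity
  simp
  field_simp

open PowerSeries in
theorem cast_E_eq (n k : ℕ) :
    (E n k : ℚ) = (2 * n).factorial * coeff (2 * n) (coshSubOne ^ k) := by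
  classical
  have indicator (f : Fin (2 * n) → Fin k) :
      (if Function.Surjective f ∧
        ∀ i : Fin k, Even (Finset.univ.filter (fun x => f x = i)).card then (1 : ℚ) else 0) =
      ∑ τ : Fin k → Fin 3, (∏ i, weight (τ i)) * ∏ x, node (τ (f x)) := by
    have key : (Function.Surjective f ∧
        ∀ i : Fin k, Even (Finset.univ.filter (fun x => f x = i)).card) ↔
        ∀ i ∈ (Finset.univ : Finset (Fin k)),
          Even (Finset.univ.filter (fun x => f x = i)).card ∧
          (Finset.univ.filter (fun x => f x = i)).card ≠ 0 := by
      simp only [Finset.mem_univ, true_imp_iff, forall_and, Finset.card_ne_zero,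
        Finset.filter_nonempty_iff, true_and]
      exact and_comm
    trans ∏ i, if Even (Finset.univ.filter (fun x => f x = i)).card ∧
      (Finset.univ.filter (fun x => f x = i)).card ≠ 0 then (1 : ℚ) else 0
    · rw [Finset.prod_boole]
      simp only [key]
      congr
    simp_rw [← sum_weight_mul_node_pow]
    rw [Finset.prod_univ_sum, Fintype.piFinset_univ]
    refine Finset.sum_congr rfl fun τ _ => ?_
    rw [Finset.prod_mul_distrib, ← Finset.prod_fiberwise' Finset.univ f fun i => node (τ i)]
    simp
  rw [factorial_mul_coeff_coshSubOne_pow, E, Nat.card_eq_fintype_card, Fintype.card_subtype,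
    Finset.natCast_card_filter, Finset.sum_congr rfl fun f _ => indicator f, Finset.sum_comm]
  refine Finset.sum_congr rfl fun τ _ => ?_
  rw [← Finset.mul_sum, Fintype.sum_pow]

open PowerSeries in
theorem coshSubOne_eq : coshSubOne =
    C (1 / 2) * exp ℚ + C (1 / 2) * rescale (-1) (exp ℚ) - 1 := by
  simp [coshSubOne, Fin.sum_univ_three, weight, node, sub_eq_add_neg]

open PowerSeries in
theorem derivative_derivative_coshSubOne_pow (j : ℕ) :
    d⁄dX ℚ (d⁄dX ℚ (coshSubOne ^ (j + 1))) =
      C (((j : ℚ) + 1) ^ 2) * coshSubOne ^ (j + 1) +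
        C (((j : ℚ) + 1) * (2 * j + 1)) * coshSubOne ^ j := by
  set S : PowerSeries ℚ := C (1 / 2) * exp ℚ - C (1 / 2) * rescale (-1) (exp ℚ) with hS
  have hexp : d⁄dX ℚ (exp ℚ) = exp ℚ := by
    ext n
    simp [coeff_derivative, coeff_exp, Nat.factorial_succ]
    field_simp
  have hexpn : d⁄dX ℚ (rescale (-1) (exp ℚ)) = -rescale (-1) (exp ℚ) := by
    ext n
    simp [coeff_derivative, coeff_exp, Nat.factorial_succ, coeff_rescale, pow_succ]
    field_simp
  have hC (a : ℚ) (f : PowerSeries ℚ) : d⁄dX ℚ (C a * f) = C a * d⁄dX ℚ f := by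
    rw [← smul_eq_C_mul, ← smul_eq_C_mul, Derivation.map_smul]
  have hd : d⁄dX ℚ coshSubOne = S := by
    rw [coshSubOne_eq, map_sub, map_add, hC, hC, hexp, hexpn, Derivation.map_one_eq_zero, hS]
    ring
  have hdS : d⁄dX ℚ S = coshSubOne + 1 := by
    rw [hS, coshSubOne_eq, map_sub, hC, hC, hexp, hexpn]
    ring
  have hmul : exp ℚ * rescale (-1) (exp ℚ) = 1 := exp_mul_exp_neg_eq_one
  have hhalf : (C (1 / 2 : ℚ) : PowerSeries ℚ) * 2 = 1 := by
    rw [show (2 : PowerSeries ℚ) = C (2 : ℚ) from (map_ofNat C 2).symm, ← map_mul]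
    norm_num
  have hSS : S ^ 2 = coshSubOne ^ 2 + 2 * coshSubOne := by
    rw [hS, coshSubOne_eq]
    linear_combination (-4 * C (1 / 2 : ℚ) ^ 2) * hmul - (C (1 / 2 : ℚ) * 2 + 1) * hhalf
  have hcast : (C (j : ℚ) : PowerSeries ℚ) = j := map_natCast C j
  rw [Derivation.leibniz_pow, hd, map_nsmul, smul_eq_mul, Derivation.leibniz, Derivation.leibniz_pow, hd, hdS]
  simp only [smul_eq_mul, nsmul_eq_mul, map_pow, map_add, map_mul, map_one, hcast, map_ofNat,
    Nat.add_sub_cancel, Nat.cast_add, Nat.cast_one]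
  clear_value S
  rcases j with _ | j
  · simp
  · simp only [Nat.add_sub_cancel]
    push_cast
    linear_combination ((j + 1 + 1 : PowerSeries ℚ) * (j + 1) * coshSubOne ^ j) * hSS

open PowerSeries in
theorem E_succ_succ (n j : ℕ) :
    E (n + 1) (j + 1) = (j + 1) ^ 2 * E n (j + 1) + (j + 1) * (2 * j + 1) * E n j := by
  have h := congrArg (coeff (2 * n)) (derivative_derivative_coshSubOne_pow j)
  rw [coeff_derivative, coeff_derivative, map_add, coeff_C_mul, coeff_C_mul] at h
  have : (E (n + 1) (j + 1) : ℚ) =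
      (j + 1) ^ 2 * E n (j + 1) + (j + 1) * (2 * j + 1) * E n j := by
    rw [cast_E_eq, cast_E_eq, cast_E_eq, show 2 * (n + 1) = 2 * n + 1 + 1 by ring,
      Nat.factorial_succ, Nat.factorial_succ]
    push_cast at h ⊢
    linear_combination ((2 * n).factorial : ℚ) * h
  exact_mod_cast this

theorem E_zero_zero : E 0 0 = 1 := by
  have h := cast_E_eq 0 0
  simp at h
  exact h

open PowerSeries in
theorem E_eq_zero_of_lt {n k : ℕ} (h : n < k) : E n k = 0 := by
  induction n generalizing k with
  | zero =>
    have hE := cast_E_eq 0 k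
    have hzero : coeff 0 coshSubOne = 0 := by
      simp [coshSubOne_eq, -coeff_zero_eq_constantCoeff, coeff_rescale, coeff_exp]
      norm_num
    rw [coeff_zero_eq_constantCoeff_apply] at hzero
    simpa [hzero, h.ne'] using hE
  | succ n ih =>
    obtain ⟨j, rfl⟩ := Nat.exists_eq_succ_of_ne_zero (show k ≠ 0 by omega)
    rw [Nat.succ_eq_add_one, E_succ_succ, ih (by omega), ih (by omega)]
    simp

theorem evenOSP_recurrence :
    (∀ n : ℕ, (E n n : ℚ) = (Nat.factorial (2 * n) : ℚ) / 2 ^ n) ∧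
    (∀ n k : ℕ, 1 ≤ k → k ≤ n - 1 →
      E n k = k ^ 2 * E (n - 1) k + k * (2 * k - 1) * E (n - 1) (k - 1)) := by
  refine ⟨fun n => ?_, fun n k hk hkn => ?_⟩
  · induction n with
    | zero => simp [E_zero_zero]
    | succ n ih =>
      rw [E_succ_succ, E_eq_zero_of_lt n.lt_succ_self, show 2 * (n + 1) = 2 * n + 1 + 1 by ring,
        Nat.factorial_succ, Nat.factorial_succ]
      push_cast
      rw [ih]
      field_simp
      ring
  · obtain ⟨n, rfl⟩ := Nat.exists_eq_succ_of_ne_zero (show n ≠ 0 by omega)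
    obtain ⟨j, rfl⟩ := Nat.exists_eq_succ_of_ne_zero (show k ≠ 0 by omega)
    simpa [show 2 * (j + 1) - 1 = 2 * j + 1 by omega] using E_succ_succ n j
end

section
/- Let (a_n)_{n≥0} be a sequence of real numbers and let k ≥ 0 be an integer. If a_n → 1 as n → ∞, then (1/C(n+k,k)) · Σ_{n_0+n_1+...+n_k = n} a_{n_0}·a_{n_1}·...·a_{n_k} → 1 as n → ∞, where the sum is over all (k+1)-tuples (n_0,...,n_k) of nonnegative integers summing to n and C(n+k,k) is the binomial coefficient. -/
open Finset.HasAntidiagonal (antidiagonal)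

/-- Split off the first coordinate in a sum over tuples with a prescribed sum. -/
theorem sum_antidiagonalTuple_succ {M : Type*} [AddCommMonoid M] (k n : ℕ)
    (f : (Fin (k + 1) → ℕ) → M) :
    ∑ v ∈ Finset.Nat.antidiagonalTuple (k + 1) n, f v =
      ∑ p ∈ antidiagonal n, ∑ v ∈ Finset.Nat.antidiagonalTuple k p.2,
        f (Fin.cons p.1 v) := by
  rw [Finset.sum_sigma']
  refine Finset.sum_bij' (fun v _ => ⟨(v 0, ∑ i, Fin.tail v i), Fin.tail v⟩)
    (fun q _ => Fin.cons q.1.1 q.2) ?_ ?_ ?_ ?_ ?_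
  · intro v hv
    rw [Finset.Nat.mem_antidiagonalTuple, Fin.sum_univ_succ] at hv
    simpa [Finset.Nat.mem_antidiagonalTuple, Fin.tail] using hv
  · rintro ⟨⟨i, j⟩, v⟩ hq
    simp only [Finset.mem_sigma, Finset.HasAntidiagonal.mem_antidiagonal,
      Finset.Nat.mem_antidiagonalTuple] at hq
    simp [Finset.Nat.mem_antidiagonalTuple, Fin.sum_univ_succ, hq]
  · intro v _
    simp
  · rintro ⟨⟨i, j⟩, v⟩ hq
    simp only [Finset.mem_sigma, Finset.HasAntidiagonal.mem_antidiagonal,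
      Finset.Nat.mem_antidiagonalTuple] at hq
    obtain ⟨-, rfl⟩ := hq
    simp
  · intro v _
    simp

theorem sum_antidiagonal_choose_add (k n : ℕ) :
    ∑ p ∈ antidiagonal n, ((p.2 + k).choose k : ℝ) = ((n + (k + 1)).choose (k + 1) : ℝ) := by
  rw [← Finset.Nat.sum_antidiagonal_swap,
    Finset.Nat.sum_antidiagonal_eq_sum_range_succ_mk]
  exact_mod_cast Nat.sum_range_add_choose n k

/-- The binomially weighted convolution average of two sequences is controlled by the arithmetic
mean of their distances to `1`. -/
theorem abs_weighted_average_sub_one_le (k n : ℕ) {a b : ℕ → ℝ} {B : ℝ} (hB : ∀ j, |b j| ≤ B) :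
    |(1 / ((n + (k + 1)).choose (k + 1) : ℝ)) *
        ∑ p ∈ antidiagonal n, a p.1 * (b p.2 * ((p.2 + k).choose k : ℝ)) - 1| ≤
      (k + 1) * (((n + 1 : ℕ) : ℝ)⁻¹ *
        ∑ i ∈ Finset.range (n + 1), (B * |a i - 1| + |b i - 1|)) := by
  have hW : (0 : ℝ) < ((n + (k + 1)).choose (k + 1) : ℝ) := by
    exact_mod_cast Nat.choose_pos (by omega)
  have hsum : (1 / ((n + (k + 1)).choose (k + 1) : ℝ)) *
        ∑ p ∈ antidiagonal n, a p.1 * (b p.2 * ((p.2 + k).choose k : ℝ)) - 1 =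
      (∑ p ∈ antidiagonal n, (a p.1 * b p.2 - 1) * ((p.2 + k).choose k : ℝ)) /
        ((n + (k + 1)).choose (k + 1) : ℝ) := by
    simp only [sub_mul, one_mul, Finset.sum_sub_distrib, sum_antidiagonal_choose_add, mul_assoc]
    field_simp
  have hsplit : ∑ p ∈ antidiagonal n, (B * |a p.1 - 1| + |b p.2 - 1|) =
      ∑ i ∈ Finset.range (n + 1), (B * |a i - 1| + |b i - 1|) := by
    rw [Finset.sum_add_distrib, Finset.sum_add_distrib,
      ← Finset.Nat.sum_antidiagonal_swap (f := fun p : ℕ × ℕ => |b p.2 - 1|),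
      Finset.Nat.sum_antidiagonal_eq_sum_range_succ_mk,
      Finset.Nat.sum_antidiagonal_eq_sum_range_succ_mk]
    rfl
  have hnum : |∑ p ∈ antidiagonal n, (a p.1 * b p.2 - 1) * ((p.2 + k).choose k : ℝ)| ≤
      (∑ i ∈ Finset.range (n + 1), (B * |a i - 1| + |b i - 1|)) * ((n + k).choose k : ℝ) := by
    rw [← hsplit, Finset.sum_mul]
    refine (Finset.abs_sum_le_sum_abs _ _).trans (Finset.sum_le_sum fun p hp => ?_)
    have hp2 : p.2 ≤ n := by
      rw [Finset.HasAntidiagonal.mem_antidiagonal] at hp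
      omega
    have hterm : |a p.1 * b p.2 - 1| ≤ B * |a p.1 - 1| + |b p.2 - 1| := by
      calc |a p.1 * b p.2 - 1| = |b p.2 * (a p.1 - 1) + (b p.2 - 1)| := by ring_nf
        _ ≤ |b p.2 * (a p.1 - 1)| + |b p.2 - 1| := abs_add_le _ _
        _ ≤ B * |a p.1 - 1| + |b p.2 - 1| := by
          rw [abs_mul]
          gcongr
          exact hB _
    have hchoose : ((p.2 + k).choose k : ℝ) ≤ ((n + k).choose k : ℝ) := by
      exact_mod_cast Nat.choose_le_choose k (by omega)
    rw [abs_mul, Nat.abs_cast]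
    exact mul_le_mul hterm hchoose (Nat.cast_nonneg _) ((abs_nonneg _).trans hterm)
  have hratio : ((n + k).choose k : ℝ) / ((n + (k + 1)).choose (k + 1) : ℝ) ≤
      (k + 1) * ((n + 1 : ℕ) : ℝ)⁻¹ := by
    rw [← div_eq_mul_inv, div_le_div_iff₀ hW (by positivity)]
    have h : ((n + k + 1 : ℕ) : ℝ) * ((n + k).choose k : ℝ) =
        ((n + (k + 1)).choose (k + 1) : ℝ) * (k + 1) := by
      exact_mod_cast Nat.add_one_mul_choose_eq (n + k) k
    rw [mul_comm ((k : ℝ) + 1), ← h, mul_comm]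
    gcongr
    omega
  have hB0 : 0 ≤ B := (abs_nonneg _).trans (hB 0)
  rw [hsum, abs_div, abs_of_pos hW]
  calc _ ≤ (∑ i ∈ Finset.range (n + 1), (B * |a i - 1| + |b i - 1|)) * ((n + k).choose k : ℝ) /
        ((n + (k + 1)).choose (k + 1) : ℝ) := by gcongr
    _ = (∑ i ∈ Finset.range (n + 1), (B * |a i - 1| + |b i - 1|)) *
        (((n + k).choose k : ℝ) / ((n + (k + 1)).choose (k + 1) : ℝ)) := mul_div_assoc _ _ _
    _ ≤ (∑ i ∈ Finset.range (n + 1), (B * |a i - 1| + |b i - 1|)) *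
        ((k + 1) * ((n + 1 : ℕ) : ℝ)⁻¹) := by gcongr
    _ = _ := by ring

theorem tendsto_weighted_average (k : ℕ) {a b : ℕ → ℝ}
    (ha : Filter.Tendsto a Filter.atTop (nhds 1)) (hb : Filter.Tendsto b Filter.atTop (nhds 1)) :
    Filter.Tendsto
      (fun n : ℕ => (1 / ((n + (k + 1)).choose (k + 1) : ℝ)) *
        ∑ p ∈ antidiagonal n, a p.1 * (b p.2 * ((p.2 + k).choose k : ℝ)))
      Filter.atTop (nhds 1) := by
  obtain ⟨B, hB⟩ := (Metric.isBounded_range_of_tendsto b hb).exists_norm_le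
  have hB' : ∀ j, |b j| ≤ B := fun j => hB _ ⟨j, rfl⟩
  have hc : Filter.Tendsto (fun i => B * |a i - 1| + |b i - 1|) Filter.atTop (nhds 0) := by
    simpa using ((ha.sub_const 1).abs.const_mul B).add (hb.sub_const 1).abs
  have hmean := ((hc.cesaro.comp (Filter.tendsto_add_atTop_nat 1)).const_mul ((k : ℝ) + 1))
  rw [mul_zero] at hmean
  rw [tendsto_iff_norm_sub_tendsto_zero]
  exact squeeze_zero (fun _ => norm_nonneg _)
    (fun n => abs_weighted_average_sub_one_le k n hB') hmean

theorem avg_of_products_tendsto_one (k : ℕ) (a : ℕ → ℝ)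
    (ha : Filter.Tendsto a Filter.atTop (nhds 1)) :
    Filter.Tendsto
      (fun n : ℕ => (1 / (Nat.choose (n + k) k : ℝ)) *
        ∑ v ∈ Finset.Nat.antidiagonalTuple (k + 1) n, ∏ i, a (v i))
      Filter.atTop (nhds 1) := by
  induction k with
  | zero => simpa using ha
  | succ k ih =>
    refine (tendsto_weighted_average k ha ih).congr fun n => ?_
    rw [sum_antidiagonalTuple_succ (k + 1) n]
    congr 1
    refine Finset.sum_congr rfl fun p _ => ?_
    have hW : ((p.2 + k).choose k : ℝ) ≠ 0 := by
      exact_mod_cast (Nat.choose_pos (by omega)).ne'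
    simp only [Fin.prod_univ_succ (n := k + 1), Fin.cons_zero, Fin.cons_succ, ← Finset.mul_sum]
    field_simp
end

section
/- Let c(n,k) denote the unsigned Stirling number of the first kind. For each fixed nonnegative integer k: (1) c(n, n-k) · 2^k · k! / n^{2k} → 1 as n → ∞ (that is, c(n,n-k) ~ n^{2k}/(2^k·k!)); and (2) c(n, n-k) ≤ n^{2k}/(2^k·k!) for all n ≥ k, as an inequality of rational (or real) numbers. -/
theorem c1_eq_zero_of_lt : ∀ {n k : ℕ}, n < k → c1 n k = 0
  | 0, _ + 1, _ => by rw [c1]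
  | n + 1, k + 1, h => by
    rw [c1, c1_eq_zero_of_lt (show n < k + 1 by omega), c1_eq_zero_of_lt (show n < k by omega),
      mul_zero]

theorem c1_self (n : ℕ) : c1 n n = 1 := by
  induction n with
  | zero => rw [c1]
  | succ n ih => rw [c1, c1_eq_zero_of_lt n.lt_succ_self, ih, mul_zero]

theorem pow_succ_add_le_succ_pow (n p : ℕ) :
    n ^ (p + 1) + (p + 1) * n ^ p ≤ (n + 1) ^ (p + 1) := by
  induction p with
  | zero => simp
  | succ p ih =>
    calc n ^ (p + 1 + 1) + (p + 1 + 1) * n ^ (p + 1)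
        ≤ (n ^ (p + 1) + (p + 1) * n ^ p) * (n + 1) := by
          ring_nf
          nlinarith [Nat.zero_le (p * n ^ p), Nat.zero_le (n ^ p)]
      _ ≤ (n + 1) ^ (p + 1) * (n + 1) := Nat.mul_le_mul_right _ ih
      _ = (n + 1) ^ (p + 1 + 1) := (pow_succ _ _).symm

theorem succ_pow_le_pow_succ_add (n p : ℕ) :
    (n + 1) ^ (p + 1) ≤ n ^ (p + 1) + (p + 1) * (n + 1) ^ p := by
  induction p with
  | zero => simp
  | succ p ih =>
    have h : n ^ (p + 1) ≤ (n + 1) ^ (p + 1) := Nat.pow_le_pow_left n.le_succ _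
    calc (n + 1) ^ (p + 1 + 1) = n * (n + 1) ^ (p + 1) + (n + 1) ^ (p + 1) := by ring
      _ ≤ n * (n ^ (p + 1) + (p + 1) * (n + 1) ^ p) + (n + 1) ^ (p + 1) := by gcongr
      _ = n ^ (p + 1 + 1) + (p + 1) * (n * (n + 1) ^ p) + (n + 1) ^ (p + 1) := by ring
      _ ≤ n ^ (p + 1 + 1) + (p + 1) * ((n + 1) * (n + 1) ^ p) + (n + 1) ^ (p + 1) := by
          gcongr; exact n.le_succ
      _ = n ^ (p + 1 + 1) + (p + 1 + 1) * (n + 1) ^ (p + 1) := by ring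

theorem c1_add_succ_succ (m k : ℕ) :
    c1 (m + 1 + (k + 1)) (m + 1) =
      (m + 1 + k) * c1 (m + 1 + k) (m + 1) + c1 (m + (k + 1)) m := by
  rw [show m + 1 + (k + 1) = m + 1 + k + 1 by ring, c1, show m + (k + 1) = m + 1 + k by ring]

theorem c1_add_mul_le (k m : ℕ) :
    c1 (m + k) m * (2 ^ k * k.factorial) ≤ (m + k) ^ (2 * k) := by
  induction k generalizing m with
  | zero => simp [c1_self]
  | succ k ihk =>
    induction m with
    | zero => rw [zero_add, c1]; simp
    | succ m ihm =>
      calc c1 (m + 1 + (k + 1)) (m + 1) * (2 ^ (k + 1) * (k + 1).factorial)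
          = c1 (m + (k + 1)) m * (2 ^ (k + 1) * (k + 1).factorial) +
            (2 * k + 1 + 1) * (m + 1 + k) *
              (c1 (m + 1 + k) (m + 1) * (2 ^ k * k.factorial)) := by
            rw [c1_add_succ_succ, Nat.factorial_succ]; ring
        _ ≤ (m + (k + 1)) ^ (2 * (k + 1)) +
            (2 * k + 1 + 1) * (m + 1 + k) * (m + 1 + k) ^ (2 * k) := by
            gcongr
            exact ihk (m + 1)
        _ = (m + 1 + k) ^ (2 * k + 1 + 1) + (2 * k + 1 + 1) * (m + 1 + k) ^ (2 * k + 1) := by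
            rw [show m + (k + 1) = m + 1 + k by ring]; ring
        _ ≤ (m + 1 + k + 1) ^ (2 * k + 1 + 1) := pow_succ_add_le_succ_pow _ _
        _ = (m + 1 + (k + 1)) ^ (2 * (k + 1)) := by ring

theorem pow_le_c1_add_mul (k m : ℕ) :
    m ^ (2 * k) ≤ c1 (m + k) m * (2 ^ k * k.factorial) := by
  induction k generalizing m with
  | zero => simp [c1_self]
  | succ k ihk =>
    induction m with
    | zero => simp
    | succ m ihm =>
      calc (m + 1) ^ (2 * (k + 1)) = (m + 1) ^ (2 * k + 1 + 1) := by ring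
        _ ≤ m ^ (2 * k + 1 + 1) + (2 * k + 1 + 1) * (m + 1) ^ (2 * k + 1) :=
            succ_pow_le_pow_succ_add _ _
        _ = m ^ (2 * (k + 1)) + (2 * k + 1 + 1) * (m + 1) * (m + 1) ^ (2 * k) := by ring
        _ ≤ c1 (m + (k + 1)) m * (2 ^ (k + 1) * (k + 1).factorial) +
            (2 * k + 1 + 1) * (m + 1 + k) *
              (c1 (m + 1 + k) (m + 1) * (2 ^ k * k.factorial)) := by
            exact Nat.add_le_add ihm (Nat.mul_le_mul
              (Nat.mul_le_mul_left _ (Nat.le_add_right _ _)) (ihk (m + 1)))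
        _ = c1 (m + 1 + (k + 1)) (m + 1) * (2 ^ (k + 1) * (k + 1).factorial) := by
            rw [c1_add_succ_succ, Nat.factorial_succ]; ring

theorem stirling_first_kind_asymptotic (k : ℕ) :
    Filter.Tendsto
      (fun n : ℕ => (c1 n (n - k) : ℝ) * 2 ^ k * (Nat.factorial k : ℝ) /
        (n : ℝ) ^ (2 * k))
      Filter.atTop (nhds 1) ∧
    ∀ n : ℕ, k ≤ n →
      (c1 n (n - k) : ℚ) ≤ (n : ℚ) ^ (2 * k) / (2 ^ k * (Nat.factorial k : ℚ)) := by
  constructor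
  · have hlim : Filter.Tendsto (fun n : ℕ => (1 - (k : ℝ) / n) ^ (2 * k))
        Filter.atTop (nhds 1) := by
      simpa using ((tendsto_const_div_atTop_nhds_zero_nat (k : ℝ)).const_sub 1).pow (2 * k)
    refine tendsto_of_tendsto_of_tendsto_of_le_of_le' hlim tendsto_const_nhds ?_ ?_
    · filter_upwards [Filter.eventually_ge_atTop k, Filter.eventually_gt_atTop 0] with n hk hn
      obtain ⟨m, rfl⟩ := Nat.exists_eq_add_of_le' hk
      have hpos : (0 : ℝ) < ((m + k : ℕ) : ℝ) := by exact_mod_cast hn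
      have h : (m : ℝ) ^ (2 * k) ≤ c1 (m + k) m * (2 ^ k * (k.factorial : ℝ)) := by
        exact_mod_cast pow_le_c1_add_mul k m
      rw [one_sub_div hpos.ne', div_pow, Nat.add_sub_cancel, mul_assoc]
      gcongr
      simpa using h
    · filter_upwards [Filter.eventually_ge_atTop k] with n hk
      obtain ⟨m, rfl⟩ := Nat.exists_eq_add_of_le' hk
      rw [Nat.add_sub_cancel, mul_assoc]
      refine div_le_one_of_le₀ ?_ (by positivity)
      exact_mod_cast c1_add_mul_le k m
  · intro n hk
    obtain ⟨m, rfl⟩ := Nat.exists_eq_add_of_le' hk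
    rw [Nat.add_sub_cancel, le_div_iff₀ (by positivity)]
    exact_mod_cast c1_add_mul_le k m
end
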